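/- arXiv:2110.10304 — 2 statements merged into one kernel-verified Lean document; each statement's English description precedes it below -/
import Mathlib

section
/- Let σ be the strictly increasing enumeration of the positive integers that are not squares of odd integers. For a sequence x : {1,2,...} → ℂ define (Ux)_n = x_{n²} if n is odd and (Ux)_n = x_{σ(n/2)} if n is even. Then for every x with Σ_{n≥1} n|x_n|² < ∞, one has Σ_{n≥1} n|(Ux)_n|² ≤ 2·Σ_{n≥1} n|x_n|². -/
/-- A weighted `ℓ²` estimate for composition with an injection that at most doubles the weight. -/
theorem weighted_sq_comp_bound (τ : ℕ → ℕ) (hτ : Function.Injective τ)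
    (hle : ∀ n, n ≤ 2 * τ n) (x y : ℕ → ℂ) (hy : ∀ n, 1 ≤ n → y n = x (τ n))
    (hx : Summable fun n : ℕ => (n : ℝ) * ‖x n‖ ^ 2) :
    (Summable fun n : ℕ => (n : ℝ) * ‖y n‖ ^ 2) ∧
      (∑' n : ℕ, (n : ℝ) * ‖y n‖ ^ 2) ≤ 2 * ∑' n : ℕ, (n : ℝ) * ‖x n‖ ^ 2 := by
  have hcomp : Summable fun n : ℕ => 2 * ((τ n : ℝ) * ‖x (τ n)‖ ^ 2) :=
    (hx.comp_injective hτ).mul_left 2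
  have hterm : ∀ n : ℕ, (n : ℝ) * ‖y n‖ ^ 2 ≤ 2 * ((τ n : ℝ) * ‖x (τ n)‖ ^ 2) := by
    intro n
    rcases Nat.eq_zero_or_pos n with rfl | hn
    · simp only [Nat.cast_zero, zero_mul]
      positivity
    · rw [hy n hn, ← mul_assoc]
      gcongr
      exact_mod_cast hle n
  have hsum : Summable fun n : ℕ => (n : ℝ) * ‖y n‖ ^ 2 :=
    Summable.of_nonneg_of_le (fun n => by positivity) hterm hcomp
  refine ⟨hsum, (hsum.tsum_le_tsum hterm hcomp).trans ?_⟩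
  rw [tsum_mul_left]
  exact mul_le_mul_of_nonneg_left
    (tsum_comp_le_tsum_of_inj hx (fun n => by positivity) hτ) zero_le_two

/-- Let `σ` be the strictly increasing enumeration of the positive integers that
are not squares of odd integers. For a sequence `x` on the positive integers define
`(Ux)_n = x_{n²}` if `n` is odd and `(Ux)_n = x_{σ(n/2)}` if `n` is even. Then for every `x`
with `Σ n|x_n|² < ∞`, one has `Σ n|(Ux)_n|² ≤ 2·Σ n|x_n|²` (the left-hand series being
convergent as well). -/
theorem weighted_l2_bound_for_U
    (σ : ℕ → ℕ)
    (hpos : ∀ k, 1 ≤ k → 1 ≤ σ k)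
    (hmem : ∀ k, 1 ≤ k → ¬ ∃ j : ℕ, σ k = (2 * j + 1) ^ 2)
    (hmono : ∀ k l, 1 ≤ k → k < l → σ k < σ l)
    (hsurj : ∀ m, 1 ≤ m → (¬ ∃ j : ℕ, m = (2 * j + 1) ^ 2) → ∃ k, 1 ≤ k ∧ σ k = m)
    (x Ux : ℕ → ℂ)
    (hUodd : ∀ n, 1 ≤ n → Odd n → Ux n = x (n ^ 2))
    (hUeven : ∀ n, 1 ≤ n → Even n → Ux n = x (σ (n / 2)))
    (hx : Summable fun n : ℕ => (n : ℝ) * ‖x n‖ ^ 2) :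
    (Summable fun n : ℕ => (n : ℝ) * ‖Ux n‖ ^ 2) ∧
      (∑' n : ℕ, (n : ℝ) * ‖Ux n‖ ^ 2) ≤ 2 * ∑' n : ℕ, (n : ℝ) * ‖x n‖ ^ 2 := by
  have hσ_le : ∀ k, 1 ≤ k → k ≤ σ k := by
    intro k hk
    induction k, hk using Nat.le_induction with
    | base => exact hpos 1 le_rfl
    | succ k hk ih => exact ih.trans_lt (hmono k (k + 1) hk k.lt_succ_self)
  have hσ_inj : ∀ k l, 1 ≤ k → 1 ≤ l → σ k = σ l → k = l := by
    intro k l hk hl h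
    rcases lt_trichotomy k l with hkl | hkl | hkl
    · exact absurd h (hmono k l hk hkl).ne
    · exact hkl
    · exact absurd h (hmono l k hl hkl).ne'
  let τ : ℕ → ℕ := fun n => if n = 0 then 0 else if Odd n then n ^ 2 else σ (n / 2)
  have hτ_zero : τ 0 = 0 := by simp [τ]
  have hτ_odd : ∀ n, Odd n → τ n = n ^ 2 := fun n hn => by
    simp [τ, hn, hn.pos.ne']
  have hτ_even : ∀ n, 1 ≤ n → Even n → τ n = σ (n / 2) := fun n hn he => by
    simp [τ, Nat.not_odd_iff_even.mpr he, Nat.one_le_iff_ne_zero.mp hn]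
  have hτ_le : ∀ n, n ≤ 2 * τ n := by
    intro n
    rcases Nat.eq_zero_or_pos n with rfl | hn
    · exact Nat.zero_le _
    rcases Nat.even_or_odd n with he | ho
    · rw [hτ_even n hn he]
      obtain ⟨k, rfl⟩ := he
      have := hσ_le ((k + k) / 2) (by omega)
      omega
    · rw [hτ_odd n ho]
      nlinarith
  have hτ_ne : ∀ m n, 1 ≤ m → Even m → Odd n → τ m ≠ τ n := by
    intro m n hm he ho h
    rw [hτ_even m hm he, hτ_odd n ho] at h
    obtain ⟨j, rfl⟩ := ho
    obtain ⟨k, rfl⟩ := he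
    exact hmem ((k + k) / 2) (by omega) ⟨j, h⟩
  have hτ_inj : Function.Injective τ := by
    intro m n h
    rcases Nat.eq_zero_or_pos m with rfl | hm
    · have := hτ_le n
      omega
    rcases Nat.eq_zero_or_pos n with rfl | hn
    · have := hτ_le m
      omega
    rcases Nat.even_or_odd m with hme | hmo <;> rcases Nat.even_or_odd n with hne | hno
    · rw [hτ_even m hm hme, hτ_even n hn hne] at h
      obtain ⟨k, rfl⟩ := hme
      obtain ⟨l, rfl⟩ := hne
      have := hσ_inj _ _ (by omega) (by omega) h
      omega
    · exact absurd h (hτ_ne m n hm hme hno)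
    · exact absurd h.symm (hτ_ne n m hn hne hmo)
    · rw [hτ_odd m hmo, hτ_odd n hno] at h
      exact Nat.pow_left_injective two_ne_zero h
  refine weighted_sq_comp_bound τ hτ_inj hτ_le x Ux (fun n hn => ?_) hx
  rcases Nat.even_or_odd n with he | ho
  · rw [hUeven n hn he, hτ_even n hn he]
  · rw [hUodd n hn ho, hτ_odd n ho]
end

section
/- Define sequences x and y on the positive integers by: x_n = n^{-3/2} if n is odd and x_n = 0 otherwise; y_m = m^{-3/4} if m is the square of an odd positive integer and y_m = 0 otherwise. Then Σ_{n≥1} n|x_n|² < ∞ (i.e. Σ_{k≥0} (2k+1)·(2k+1)^{-3} converges), but Σ_{m≥1} m|y_m|² = ∞ (i.e. the series Σ_{k≥0} 1/(2k+1) diverges). -/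
theorem natCast_mul_norm_rpow_sq {n : ℕ} (hn : 0 < n) (a : ℝ) :
    (n : ℝ) * ‖(((n : ℝ) ^ a : ℝ) : ℂ)‖ ^ 2 = (n : ℝ) ^ (1 + 2 * a) := by
  have hn' : (0 : ℝ) < n := by exact_mod_cast hn
  rw [Complex.norm_real, Real.norm_eq_abs, sq_abs, Real.rpow_add hn', Real.rpow_one,
    mul_comm 2 a, Real.rpow_mul hn'.le, Real.rpow_two]

theorem not_summable_inv_two_mul_add_one :
    ¬ Summable fun k : ℕ => ((2 * k + 1 : ℕ) : ℝ)⁻¹ := by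
  intro h
  have h1 : Summable fun k : ℕ => ((k + 1 : ℕ) : ℝ)⁻¹ := by
    refine Summable.of_nonneg_of_le (fun k => by positivity) (fun k => ?_) (h.mul_left 2)
    push_cast
    rw [← div_eq_mul_inv, inv_eq_one_div, div_le_div_iff₀ (by positivity) (by positivity)]
    linarith
  exact Real.not_summable_natCast_inv ((summable_nat_add_iff 1).mp h1)

/-- Define sequences `x` and `y` on the positive integers by `x n = n^(-3/2)`
if `n` is odd and `x n = 0` otherwise; `y m = m^(-3/4)` if `m` is the square of an odd
positive integer and `y m = 0` otherwise. Then `Σ n|x_n|² < ∞`, but `Σ m|y_m|² = ∞`. -/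
theorem weighted_l2_example
    (x y : ℕ → ℂ)
    (hx1 : ∀ n : ℕ, Odd n → x n = (((n : ℝ) ^ (-(3 : ℝ) / 2) : ℝ) : ℂ))
    (hx2 : ∀ n : ℕ, ¬ Odd n → x n = 0)
    (hy1 : ∀ m : ℕ, (∃ k : ℕ, m = (2 * k + 1) ^ 2) → y m = (((m : ℝ) ^ (-(3 : ℝ) / 4) : ℝ) : ℂ))
    (hy2 : ∀ m : ℕ, (¬ ∃ k : ℕ, m = (2 * k + 1) ^ 2) → y m = 0) :
    (Summable fun n : ℕ => (n : ℝ) * ‖x n‖ ^ 2) ∧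
      ¬ Summable fun m : ℕ => (m : ℝ) * ‖y m‖ ^ 2 := by
  constructor
  · refine Summable.of_nonneg_of_le (fun n => by positivity) (fun n => ?_)
      (Real.summable_nat_rpow.mpr (by norm_num : (-2 : ℝ) < -1))
    by_cases hn : Odd n
    · rw [hx1 n hn, natCast_mul_norm_rpow_sq hn.pos]
      norm_num
    · rw [hx2 n hn, norm_zero]
      simp only [ne_eq, OfNat.ofNat_ne_zero, not_false_eq_true, zero_pow, mul_zero]
      positivity
  · intro h
    have hinj : Function.Injective fun k : ℕ => (2 * k + 1) ^ 2 := fun a b hab => by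
      have := Nat.pow_left_injective two_ne_zero hab
      omega
    refine not_summable_inv_two_mul_add_one ((h.comp_injective hinj).congr fun k => ?_)
    rw [Function.comp_apply, hy1 _ ⟨k, rfl⟩, natCast_mul_norm_rpow_sq (by positivity),
      Nat.cast_pow, ← Real.rpow_natCast, ← Real.rpow_mul (Nat.cast_nonneg _),
      ← Real.rpow_neg_one]
    norm_num
end
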